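/- (Strong duality for constrained total-variation denoising.) Let n ≥ 2, b ∈ ℝⁿ, λ > 0. Then min_{u ∈ U} { (1/2)‖u − b‖² + λ‖Tu‖₁ } = (1/2)( ‖b‖² − min_{p ∈ P^{n−1}} h(p) ), where both minima are attained. -/

import Mathlib

open Filter Topology

section Projection

variable {E F : Type*} [NormedAddCommGroup E] [InnerProductSpace ℝ E]
  [NormedAddCommGroup F] [NormedSpace ℝ F] {U : Set E} {P : E → E}

/-- The variational inequality characterising nearest points of a convex set. -/
theorem inner_sub_nearest_le_zero (hU : Convex ℝ U)
    (hP : ∀ x, P x ∈ U ∧ ∀ y ∈ U, ‖x - P x‖ ≤ ‖x - y‖) (x : E) {y : E} (hy : y ∈ U) :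
    inner ℝ (x - P x) (y - P x) ≤ 0 := by
  have : Nonempty U := ⟨⟨y, hy⟩⟩
  refine (norm_eq_iInf_iff_real_inner_le_zero hU (hP x).1).1 (le_antisymm ?_ ?_) y hy
  · exact le_ciInf fun w => (hP x).2 w w.2
  · exact ciInf_le ⟨0, by rintro _ ⟨w, rfl⟩; positivity⟩ (⟨P x, (hP x).1⟩ : U)

/-- Nearest-point maps onto convex sets are nonexpansive. -/
theorem norm_nearest_sub_le (hU : Convex ℝ U)
    (hP : ∀ x, P x ∈ U ∧ ∀ y ∈ U, ‖x - P x‖ ≤ ‖x - y‖) (x y : E) :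
    ‖P x - P y‖ ≤ ‖x - y‖ := by
  have h₁ := inner_sub_nearest_le_zero hU hP x (hP y).1
  have h₂ := inner_sub_nearest_le_zero hU hP y (hP x).1
  have h₃ := real_inner_le_norm (x - y) (P x - P y)
  have h₄ : inner ℝ (x - y) (P x - P y) = ‖P x - P y‖ ^ 2 - inner ℝ (x - P x) (P y - P x)
      - inner ℝ (y - P y) (P x - P y) := by
    rw [← real_inner_self_eq_norm_sq]
    simp only [inner_sub_left, inner_sub_right]
    ring
  by_contra! hlt
  nlinarith [norm_nonneg (x - y), norm_nonneg (P x - P y)]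

theorem continuous_nearest (hU : Convex ℝ U)
    (hP : ∀ x, P x ∈ U ∧ ∀ y ∈ U, ‖x - P x‖ ≤ ‖x - y‖) : Continuous P :=
  (LipschitzWith.of_dist_le_mul (K := 1) fun x y => by
    simpa [dist_eq_norm] using norm_nearest_sub_le hU hP x y).continuous

theorem norm_sq_sub_norm_sub_sq (x u : E) :
    ‖x‖ ^ 2 - ‖u - x‖ ^ 2 = 2 * inner ℝ x u - ‖u‖ ^ 2 := by
  rw [norm_sub_sq_real, real_inner_comm]
  ring

/-- The squared norm minus the squared distance to `U` is a maximum over `U`. -/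
theorem two_mul_inner_sub_norm_sq_le
    (hP : ∀ x, P x ∈ U ∧ ∀ y ∈ U, ‖x - P x‖ ≤ ‖x - y‖) (x : E) {u : E} (hu : u ∈ U) :
    2 * inner ℝ x u - ‖u‖ ^ 2 ≤ ‖x‖ ^ 2 - ‖P x - x‖ ^ 2 := by
  have hle : ‖P x - x‖ ≤ ‖u - x‖ := by
    rw [norm_sub_rev, norm_sub_rev u]
    exact (hP x).2 u hu
  rw [← norm_sq_sub_norm_sub_sq]
  gcongr

/-- First-order optimality: a minimizer `p` of `‖x‖² - dist(x, U)²`, `x = b - A q`, over a convex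
set `K` also maximizes the pairing of `A q` with the nearest point at `p`. -/
theorem inner_nearest_le_of_isMinOn {K : Set F} (hK : Convex ℝ K) (hU : Convex ℝ U)
    (hP : ∀ x, P x ∈ U ∧ ∀ y ∈ U, ‖x - P x‖ ≤ ‖x - y‖) (A : F →L[ℝ] E) (b : E) {p q : F}
    (hp : p ∈ K) (hq : q ∈ K)
    (hmin : IsMinOn (fun r => ‖b - A r‖ ^ 2 - ‖P (b - A r) - (b - A r)‖ ^ 2) K p) :
    inner ℝ (A q) (P (b - A p)) ≤ inner ℝ (A p) (P (b - A p)) := by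
  let r : ℝ → F := fun t => p + t • (q - p)
  have hr : ∀ t ∈ Set.Ioo (0 : ℝ) 1, inner ℝ (A (q - p)) (P (b - A (r t))) ≤ 0 := by
    intro t ht
    have h₁ := isMinOn_iff.1 hmin (r t) (hK.add_smul_sub_mem hp hq ⟨ht.1.le, ht.2.le⟩)
    have h₂ := two_mul_inner_sub_norm_sq_le hP (b - A p) (hP (b - A (r t))).1
    rw [norm_sq_sub_norm_sub_sq (b - A (r t))] at h₁
    have h₃ : b - A p = b - A (r t) + t • A (q - p) := by
      simp only [r, map_add, map_smul]
      abel
    have h₄ : inner ℝ (b - A p) (P (b - A (r t))) = inner ℝ (b - A (r t)) (P (b - A (r t)))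
        + t * inner ℝ (A (q - p)) (P (b - A (r t))) := by
      rw [h₃, inner_add_left, real_inner_smul_left]
    by_contra! hlt
    have := mul_pos ht.1 hlt
    linarith
  have hcont : Continuous fun t => inner ℝ (A (q - p)) (P (b - A (r t))) := by
    have := continuous_nearest hU hP
    fun_prop
  have hlim : Tendsto (fun t => inner ℝ (A (q - p)) (P (b - A (r t)))) (𝓝[>] 0)
      (𝓝 (inner ℝ (A (q - p)) (P (b - A (r 0))))) :=
    (hcont.tendsto 0).mono_left nhdsWithin_le_nhds
  have hle := le_of_tendsto hlim (by
    filter_upwards [Ioo_mem_nhdsGT (zero_lt_one (α := ℝ))] with t ht using hr t ht)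
  simpa [r, inner_sub_left] using hle

end Projection

/-- The unit `ℓ∞` ball in a finite-dimensional Euclidean space is compact. -/
theorem isCompact_setOf_abs_le_one (ι : Type*) [Fintype ι] :
    IsCompact {p : EuclideanSpace ℝ ι | ∀ i, |p i| ≤ 1} := by
  have hc : IsCompact (Set.univ.pi fun _ : ι => Set.Icc (-1 : ℝ) 1) :=
    isCompact_univ_pi fun _ => isCompact_Icc
  convert (EuclideanSpace.equiv ι ℝ).toHomeomorph.isCompact_preimage.2 hc using 1
  ext p
  simp [abs_le, Set.mem_pi, -Set.pi_univ_Icc]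

theorem convex_setOf_abs_le_one (ι : Type*) [Fintype ι] :
    Convex ℝ {p : EuclideanSpace ℝ ι | ∀ i, |p i| ≤ 1} := by
  intro p hp q hq s t hs ht hst i
  have hpi := abs_le.1 (hp i)
  have hqi := abs_le.1 (hq i)
  simp only [PiLp.add_apply, PiLp.smul_apply, smul_eq_mul, abs_le]
  constructor <;> nlinarith

/-- The difference matrix is adjoint to the map `u ↦ (u i - u (i + 1))ᵢ`. -/
theorem inner_difference_eq_sum {n : ℕ}
    {L : EuclideanSpace ℝ (Fin n) →L[ℝ] EuclideanSpace ℝ (Fin (n + 1))}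
    (hL : ∀ p j, L p j =
      ∑ i : Fin n, (if j = i.castSucc then (1 : ℝ) else if j = i.succ then -1 else 0) * p i)
    (p : EuclideanSpace ℝ (Fin n)) (u : EuclideanSpace ℝ (Fin (n + 1))) :
    inner ℝ (L p) u = ∑ i : Fin n, p i * (u i.castSucc - u i.succ) := by
  simp only [PiLp.inner_apply, hL, RCLike.inner_apply, conj_trivial, Finset.mul_sum]
  rw [Finset.sum_comm]
  refine Finset.sum_congr rfl fun i _ => ?_
  have hsplit : ∀ j : Fin (n + 1),
      u j * ((if j = i.castSucc then (1 : ℝ) else if j = i.succ then -1 else 0) * p i) =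
        (if j = i.castSucc then p i * u j else 0) - (if j = i.succ then p i * u j else 0) := by
    intro j
    have := (Fin.castSucc_lt_succ (i := i)).ne
    split_ifs with h₁ h₂
    · exact absurd (h₁.symm.trans h₂) this
    all_goals ring
  simp only [hsplit, Finset.sum_sub_distrib, Finset.sum_ite_eq', Finset.mem_univ, if_true]
  ring

theorem inner_difference_le_sum_abs {n : ℕ}
    {L : EuclideanSpace ℝ (Fin n) →L[ℝ] EuclideanSpace ℝ (Fin (n + 1))}
    (hL : ∀ p j, L p j =
      ∑ i : Fin n, (if j = i.castSucc then (1 : ℝ) else if j = i.succ then -1 else 0) * p i)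
    {p : EuclideanSpace ℝ (Fin n)} (hp : ∀ i, |p i| ≤ 1) (u : EuclideanSpace ℝ (Fin (n + 1))) :
    inner ℝ (L p) u ≤ ∑ i : Fin n, |u i.castSucc - u i.succ| := by
  rw [inner_difference_eq_sum hL]
  refine Finset.sum_le_sum fun i _ => (le_abs_self _).trans ?_
  rw [abs_mul]
  exact mul_le_of_le_one_left (abs_nonneg _) (hp i)

theorem exists_inner_difference_eq_sum_abs {n : ℕ}
    {L : EuclideanSpace ℝ (Fin n) →L[ℝ] EuclideanSpace ℝ (Fin (n + 1))}
    (hL : ∀ p j, L p j =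
      ∑ i : Fin n, (if j = i.castSucc then (1 : ℝ) else if j = i.succ then -1 else 0) * p i)
    (u : EuclideanSpace ℝ (Fin (n + 1))) :
    ∃ p : EuclideanSpace ℝ (Fin n), (∀ i, |p i| ≤ 1) ∧
      inner ℝ (L p) u = ∑ i : Fin n, |u i.castSucc - u i.succ| := by
  refine ⟨WithLp.toLp 2 fun i => (SignType.sign (u i.castSucc - u i.succ) : ℝ), fun i => ?_, ?_⟩
  · change |((SignType.sign (u i.castSucc - u i.succ) : SignType) : ℝ)| ≤ 1
    cases SignType.sign (u i.castSucc - u i.succ) <;> simp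
  · rw [inner_difference_eq_sum hL]
    exact Finset.sum_congr rfl fun i _ => sign_mul_self _


/-- (Strong duality for constrained total-variation denoising.) With ambient
dimension `n+1 ≥ 2` (`1 ≤ n`), `λ > 0`, `U ⊆ ℝ^{n+1}` nonempty compact convex with
Euclidean projection `proj = Π_U`, `L` the `(n+1)×n` matrix with `L_{i,i} = 1`,
`L_{i+1,i} = −1` (as a linear map), `‖Tu‖₁ = Σ_i |u_i − u_{i+1}|`, and
`h(p) := ‖b − λLp‖² − ‖Π_U(b − λLp) − (b − λLp)‖²`:
`min_{u ∈ U} {(1/2)‖u − b‖² + λ‖Tu‖₁} = (1/2)(‖b‖² − min_{p ∈ P^n} h(p))`,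
and both minima are attained. -/
theorem stmt_15 (n : ℕ) (hn : 1 ≤ n)
    (b : EuclideanSpace ℝ (Fin (n + 1))) (lam : ℝ) (hlam : 0 < lam)
    (U : Set (EuclideanSpace ℝ (Fin (n + 1))))
    (hUne : U.Nonempty) (hUcomp : IsCompact U) (hUconv : Convex ℝ U)
    (proj : EuclideanSpace ℝ (Fin (n + 1)) → EuclideanSpace ℝ (Fin (n + 1)))
    (hproj : ∀ x, proj x ∈ U ∧ ∀ y ∈ U, ‖x - proj x‖ ≤ ‖x - y‖)
    (L : EuclideanSpace ℝ (Fin n) →L[ℝ] EuclideanSpace ℝ (Fin (n + 1)))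
    (hL : ∀ p j, L p j =
      ∑ i : Fin n, (if j = i.castSucc then (1 : ℝ) else if j = i.succ then -1 else 0) * p i)
    (h : EuclideanSpace ℝ (Fin n) → ℝ)
    (hh : ∀ p, h p = ‖b - lam • L p‖ ^ 2 - ‖proj (b - lam • L p) - (b - lam • L p)‖ ^ 2) :
    ∃ a c : ℝ,
      IsLeast {y : ℝ | ∃ u ∈ U,
        y = (1 / 2 : ℝ) * ‖u - b‖ ^ 2 +
          lam * ∑ i : Fin n, |u i.castSucc - u i.succ|} a ∧
      IsLeast {y : ℝ | ∃ p : EuclideanSpace ℝ (Fin n), (∀ i, |p i| ≤ 1) ∧ y = h p} c ∧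
      a = (1 / 2 : ℝ) * (‖b‖ ^ 2 - c) := by
  have hPcont := continuous_nearest hUconv hproj
  obtain ⟨p, hp, hmin⟩ := (isCompact_setOf_abs_le_one (Fin n)).exists_isMinOn
    (f := fun r => ‖b - (lam • L) r‖ ^ 2 - ‖proj (b - (lam • L) r) - (b - (lam • L) r)‖ ^ 2)
    ⟨0, by simp⟩ (by fun_prop)
  have hfirst := fun (q : EuclideanSpace ℝ (Fin n)) (hq : ∀ i, |q i| ≤ 1) =>
    inner_nearest_le_of_isMinOn (convex_setOf_abs_le_one (Fin n)) hUconv hproj (lam • L) b hp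
      (q := q) hq hmin
  simp only [_root_.smul_apply, real_inner_smul_left] at hfirst
  have hmin' : ∀ q : EuclideanSpace ℝ (Fin n), (∀ i, |q i| ≤ 1) → h p ≤ h q := fun q hq => by
    simpa only [hh, _root_.smul_apply] using isMinOn_iff.1 hmin q hq
  have hnorm : ∀ u : EuclideanSpace ℝ (Fin (n + 1)),
      (1 / 2 : ℝ) * ‖u - b‖ ^ 2 + lam * inner ℝ (L p) u =
        (1 / 2 : ℝ) * (‖b‖ ^ 2 - (2 * inner ℝ (b - lam • L p) u - ‖u‖ ^ 2)) := fun u => by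
    rw [norm_sub_sq_real, inner_sub_left, real_inner_smul_left, real_inner_comm b u]
    ring
  refine ⟨_, h p, ⟨⟨proj (b - lam • L p), (hproj _).1, ?_⟩, ?_⟩, ⟨⟨p, hp, rfl⟩, ?_⟩, rfl⟩
  · obtain ⟨q, hq, hqu⟩ := exists_inner_difference_eq_sum_abs hL (proj (b - lam • L p))
    have heq : inner ℝ (L p) (proj (b - lam • L p)) = _ :=
      le_antisymm (inner_difference_le_sum_abs hL hp _)
        (hqu ▸ le_of_mul_le_mul_left (hfirst q hq) hlam)
    rw [← heq, hnorm, hh, norm_sq_sub_norm_sub_sq]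
  · rintro _ ⟨u, hu, rfl⟩
    have h₁ := two_mul_inner_sub_norm_sq_le hproj (b - lam • L p) hu
    have h₂ := mul_le_mul_of_nonneg_left (inner_difference_le_sum_abs hL hp u) hlam.le
    rw [hh]
    linarith [hnorm u]
  · rintro _ ⟨q, hq, rfl⟩
    exact hmin' q hq
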